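/- For every u ∈ X, Σ_{t=1}^T ( ℓ_t(x_t) − ℓ_t(u) ) ≤ Σ_{t=1}^T (8/(μ·t))·‖g_t − p_t(x_t)‖² + Σ_{t=2}^T (4/(μ·t))·‖p_t(x_{t-1}) − p_{t-1}(x_{t-1})‖² + Σ_{t=1}^T ( 4L²/(μ·t) − μ·t/4 )·‖x_t − x_{t+1}‖² + G·D. -/

import Mathlib

open Finset RealInnerProductSpace

/-- A minimizer over a convex set of a quadratic with Hessian `c` satisfies the quadratic growth
inequality. -/
theorem quadratic_growth_of_minimizer {E : Type*} [NormedAddCommGroup E] [InnerProductSpace ℝ E]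
    {X : Set E} (hX : Convex ℝ X) {f : E → ℝ} {b c : ℝ} {w : E}
    (hf : ∀ y, f y = b + ⟪w, y⟫ + c / 2 * ‖y‖ ^ 2)
    {a : E} (ha : a ∈ X) (hmin : ∀ y ∈ X, f a ≤ f y) {y : E} (hy : y ∈ X) :
    f a + c / 2 * ‖y - a‖ ^ 2 ≤ f y := by
  have expand : ∀ r : ℝ, f (a + r • (y - a)) =
      f a + r * (f y - f a - c / 2 * ‖y - a‖ ^ 2) + r ^ 2 * (c / 2 * ‖y - a‖ ^ 2) := by
    intro r
    have hya : f y = f (a + (y - a)) := by rw [add_sub_cancel]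
    rw [hya]
    generalize y - a = d
    simp only [hf, norm_add_sq_real, inner_add_right, inner_smul_right, norm_smul, mul_pow,
      Real.norm_eq_abs, sq_abs]
    ring
  set K := f y - f a - c / 2 * ‖y - a‖ ^ 2 with hK
  set Q := c / 2 * ‖y - a‖ ^ 2
  have key : ∀ r ∈ Set.Ioc (0 : ℝ) 1, 0 ≤ K + r * Q := by
    rintro r ⟨hr0, hr1⟩
    have h := hmin _ (hX.add_smul_sub_mem ha hy ⟨hr0.le, hr1⟩)
    rw [expand r] at h
    refine nonneg_of_mul_nonneg_right (a := r) ?_ hr0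
    nlinarith
  have hlim : Filter.Tendsto (fun r : ℝ => K + r * Q) (nhdsWithin 0 (Set.Ioi 0)) (nhds K) := by
    have : Continuous fun r : ℝ => K + r * Q := by fun_prop
    simpa using (this.tendsto 0).mono_left nhdsWithin_le_nhds
  have hK0 : 0 ≤ K := ge_of_tendsto hlim <| by
    filter_upwards [Ioc_mem_nhdsGT (zero_lt_one' ℝ)] with r hr using key r hr
  linarith

theorem inner_le_inv_mul_sq_add {E : Type*} [NormedAddCommGroup E] [InnerProductSpace ℝ E]
    {c : ℝ} (hc : 0 < c) (a d : E) : ⟪a, d⟫ ≤ 1 / c * ‖a‖ ^ 2 + c / 4 * ‖d‖ ^ 2 := by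
  have h1 := real_inner_le_norm a d
  have h2 : 1 / c * ‖a‖ ^ 2 + c / 4 * ‖d‖ ^ 2 - ‖a‖ * ‖d‖ = (‖a‖ - c / 2 * ‖d‖) ^ 2 / c := by
    field_simp
    ring
  have h3 : 0 ≤ (‖a‖ - c / 2 * ‖d‖) ^ 2 / c := by positivity
  linarith

theorem norm_add_four_sq_le {E : Type*} [SeminormedAddCommGroup E] (a b c d : E) :
    ‖a + b + c + d‖ ^ 2 ≤ 4 * (‖a‖ ^ 2 + ‖b‖ ^ 2 + ‖c‖ ^ 2 + ‖d‖ ^ 2) := by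
  have h : ‖a + b + c + d‖ ≤ ‖a‖ + ‖b‖ + ‖c‖ + ‖d‖ := norm_add₄_le
  have h2 := pow_le_pow_left₀ (norm_nonneg _) h 2
  nlinarith [sq_nonneg (‖a‖ - ‖b‖), sq_nonneg (‖a‖ - ‖c‖), sq_nonneg (‖a‖ - ‖d‖),
    sq_nonneg (‖b‖ - ‖c‖), sq_nonneg (‖b‖ - ‖d‖), sq_nonneg (‖c‖ - ‖d‖)]

theorem sum_surrogate_eq_quadratic {E : Type*} [NormedAddCommGroup E] [InnerProductSpace ℝ E]
    (μ : ℝ) (g x : ℕ → E) (n : ℕ) (y : E) :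
    ∑ s ∈ Icc 1 n, (⟪g s, y - x s⟫ + μ / 2 * ‖y - x s‖ ^ 2) =
      ∑ s ∈ Icc 1 n, (μ / 2 * ‖x s‖ ^ 2 - ⟪g s, x s⟫) +
        ⟪∑ s ∈ Icc 1 n, (g s - μ • x s), y⟫ + μ * n / 2 * ‖y‖ ^ 2 := by
  have hcard : μ * n / 2 * ‖y‖ ^ 2 = ∑ _s ∈ Icc 1 n, μ / 2 * ‖y‖ ^ 2 := by
    simp
    ring
  rw [hcard, sum_inner, ← sum_add_distrib, ← sum_add_distrib]
  refine sum_congr rfl fun s _ => ?_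
  rw [norm_sub_sq_real, inner_sub_right, inner_sub_left, real_inner_smul_left,
    real_inner_comm (x s) y]
  ring

/-- OFTL on surrogate losses: regret bound with weighted movement terms. -/
theorem stmt_6 {E : Type*} [NormedAddCommGroup E] [InnerProductSpace ℝ E]
    (D G μ L : ℝ) (hD : 0 < D) (hG : 0 < G) (hμ : 0 < μ) (hL : 0 ≤ L)
    (X : Set E) (hXne : X.Nonempty) (hXconv : Convex ℝ X)
    (hXdiam : ∀ x ∈ X, ∀ y ∈ X, ‖x - y‖ ≤ D)
    (T : ℕ) (hT : 1 ≤ T)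
    (g : ℕ → E) (hg : ∀ t ∈ Finset.Icc 1 T, ‖g t‖ ≤ G)
    (x : ℕ → E) (hxX : ∀ t ∈ Finset.Icc 1 (T + 1), x t ∈ X)
    (ℓ : ℕ → E → ℝ)
    (hℓ : ∀ t ∈ Finset.Icc 1 T, ∀ y : E,
      ℓ t y = ⟪g t, y - x t⟫ + μ / 2 * ‖y - x t‖ ^ 2)
    (hxmin : ∀ t ∈ Finset.Icc 2 T, ∀ y ∈ X,
      ∑ s ∈ Finset.Icc 1 (t - 1), ℓ s (x t) + ⟪g (t - 1), x t⟫ ≤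
        ∑ s ∈ Finset.Icc 1 (t - 1), ℓ s y + ⟪g (t - 1), y⟫)
    (hxlast : ∀ y ∈ X,
      ∑ s ∈ Finset.Icc 1 T, ℓ s (x (T + 1)) ≤ ∑ s ∈ Finset.Icc 1 T, ℓ s y)
    (p : ℕ → E → E)
    (hp : ∀ t ∈ Finset.Icc 1 T, ∀ a ∈ X, ∀ b ∈ X, ‖p t a - p t b‖ ≤ L * ‖a - b‖)
    (u : E) (hu : u ∈ X) :
    ∑ t ∈ Finset.Icc 1 T, (ℓ t (x t) - ℓ t u) ≤
      ∑ t ∈ Finset.Icc 1 T, 8 / (μ * (t : ℝ)) * ‖g t - p t (x t)‖ ^ 2 +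
        ∑ t ∈ Finset.Icc 2 T,
          4 / (μ * (t : ℝ)) * ‖p t (x (t - 1)) - p (t - 1) (x (t - 1))‖ ^ 2 +
        ∑ t ∈ Finset.Icc 1 T,
          (4 * L ^ 2 / (μ * (t : ℝ)) - μ * (t : ℝ) / 4) * ‖x t - x (t + 1)‖ ^ 2 +
        G * D := by
  have hquad : ∀ n ≤ T, ∀ y, ∑ s ∈ Icc 1 n, ℓ s y =
      ∑ s ∈ Icc 1 n, (μ / 2 * ‖x s‖ ^ 2 - ⟪g s, x s⟫) +
        ⟪∑ s ∈ Icc 1 n, (g s - μ • x s), y⟫ + μ * n / 2 * ‖y‖ ^ 2 := by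
    intro n hn y
    rw [← sum_surrogate_eq_quadratic]
    refine sum_congr rfl fun s hs => hℓ s ?_ y
    rw [mem_Icc] at hs ⊢
    omega
  have hstep : ∀ n, 1 ≤ n → n + 1 ≤ T →
      -∑ s ∈ Icc 1 (n + 1), ℓ s (x (n + 2)) ≤ -∑ s ∈ Icc 1 n, ℓ s (x (n + 1)) +
        ⟪g (n + 1) - g n, x (n + 1) - x (n + 2)⟫ -
        μ * (n + 1 : ℕ) / 2 * ‖x (n + 1) - x (n + 2)‖ ^ 2 := by
    intro n hn hnT
    have hgrow := quadratic_growth_of_minimizer hXconv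
      (f := fun y => ∑ s ∈ Icc 1 n, ℓ s y + ⟪g n, y⟫)
      (b := ∑ s ∈ Icc 1 n, (μ / 2 * ‖x s‖ ^ 2 - ⟪g s, x s⟫)) (c := μ * n)
      (w := ∑ s ∈ Icc 1 n, (g s - μ • x s) + g n)
      (fun y => by rw [hquad n (by omega), inner_add_left]; ring)
      (hxX (n + 1) (by rw [mem_Icc]; omega))
      (hxmin (n + 1) (by rw [mem_Icc]; omega))
      (hxX (n + 2) (by rw [mem_Icc]; omega))
    rw [sum_Icc_succ_top (by omega), hℓ (n + 1) (by rw [mem_Icc]; omega),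
      norm_sub_rev (x (n + 1))]
    simp only [inner_sub_left, inner_sub_right] at hgrow ⊢
    push_cast
    linarith
  have hpot : ∀ n, 1 ≤ n → n ≤ T →
      -∑ s ∈ Icc 1 n, ℓ s (x (n + 1)) + 4 / (μ * n) * ‖g n - p n (x n)‖ ^ 2 +
        4 * L ^ 2 / (μ * n) * ‖x n - x (n + 1)‖ ^ 2 ≤
      ∑ t ∈ Icc 1 n, 8 / (μ * (t : ℝ)) * ‖g t - p t (x t)‖ ^ 2 +
        ∑ t ∈ Icc 2 n, 4 / (μ * (t : ℝ)) * ‖p t (x (t - 1)) - p (t - 1) (x (t - 1))‖ ^ 2 +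
        ∑ t ∈ Icc 1 n,
          (4 * L ^ 2 / (μ * (t : ℝ)) - μ * (t : ℝ) / 4) * ‖x t - x (t + 1)‖ ^ 2 +
        G * D := by
    intro n hn
    induction n, hn using Nat.le_induction with
    | base =>
      intro _
      have hx1 := hxX 1 (by rw [mem_Icc]; omega)
      have hx2 := hxX 2 (by rw [mem_Icc]; omega)
      have hinner : ⟪g 1, x 1 - x 2⟫ ≤ G * D :=
        (real_inner_le_norm _ _).trans <| mul_le_mul (hg 1 (by rw [mem_Icc]; omega))
          (hXdiam _ hx1 _ hx2) (norm_nonneg _) hG.le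
      have hA : 4 / μ * ‖g 1 - p 1 (x 1)‖ ^ 2 ≤ 8 / μ * ‖g 1 - p 1 (x 1)‖ ^ 2 := by
        gcongr
        norm_num
      have hd : 0 ≤ μ * ‖x 1 - x 2‖ ^ 2 := by positivity
      rw [← neg_sub (x 2), inner_neg_right] at hinner
      simp only [Icc_self, sum_singleton, Nat.cast_one, mul_one, Nat.reduceAdd]
      rw [hℓ 1 (by rw [mem_Icc]; omega), norm_sub_rev (x 2) (x 1)]
      simp
      linarith
    | succ n hn ih =>
      intro hnT
      have hxn := hxX n (by rw [mem_Icc]; omega)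
      have hxn1 := hxX (n + 1) (by rw [mem_Icc]; omega)
      have hn0 : (0 : ℝ) < n := by exact_mod_cast hn
      have hc : 0 < μ * (n + 1 : ℕ) := by positivity
      have hmono : 1 / (μ * (n + 1 : ℕ)) ≤ 1 / (μ * n) := by
        gcongr
        omega
      have hlip := pow_le_pow_left₀ (norm_nonneg _)
        (hp (n + 1) (by rw [mem_Icc]; omega) _ hxn1 _ hxn) 2
      rw [norm_sub_rev (x (n + 1)), mul_pow] at hlip
      have hyoung := inner_le_inv_mul_sq_add hc (g (n + 1) - g n) (x (n + 1) - x (n + 2))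
      have hsplit := norm_add_four_sq_le (g (n + 1) - p (n + 1) (x (n + 1)))
        (p (n + 1) (x (n + 1)) - p (n + 1) (x n)) (p (n + 1) (x n) - p n (x n)) (p n (x n) - g n)
      rw [sub_add_sub_cancel, sub_add_sub_cancel, sub_add_sub_cancel,
        norm_sub_rev (p n (x n))] at hsplit
      have hbound : 1 / (μ * (n + 1 : ℕ)) * ‖g (n + 1) - g n‖ ^ 2 ≤
          1 / (μ * (n + 1 : ℕ)) * (4 * (‖g (n + 1) - p (n + 1) (x (n + 1))‖ ^ 2 +
            ‖p (n + 1) (x n) - p n (x n)‖ ^ 2)) +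
          1 / (μ * n) * (4 * (L ^ 2 * ‖x n - x (n + 1)‖ ^ 2 + ‖g n - p n (x n)‖ ^ 2)) := by
        refine (mul_le_mul_of_nonneg_left (hsplit.trans ?_) (by positivity)).trans
          (le_of_eq_of_le (mul_add _ _ _)
            (add_le_add le_rfl (mul_le_mul_of_nonneg_right hmono (by positivity))))
        linarith
      have := ih (by omega)
      have := hstep n hn hnT
      rw [sum_Icc_succ_top (f := fun t : ℕ => 8 / (μ * (t : ℝ)) * ‖g t - p t (x t)‖ ^ 2) (by omega),
        sum_Icc_succ_top (a := 2) (by omega),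
        sum_Icc_succ_top (f := fun t : ℕ => (4 * L ^ 2 / (μ * (t : ℝ)) - μ * (t : ℝ) / 4) *
          ‖x t - x (t + 1)‖ ^ 2) (by omega)]
      simp only [Nat.add_sub_cancel, add_assoc, Nat.reduceAdd] at *
      simp only [div_eq_mul_inv] at *
      linarith
  have hzero : ∑ t ∈ Icc 1 T, ℓ t (x t) = 0 :=
    sum_eq_zero fun t ht => by simp [hℓ t ht]
  have hA : 0 ≤ 4 / (μ * T) * ‖g T - p T (x T)‖ ^ 2 := by positivity
  have hd : 0 ≤ 4 * L ^ 2 / (μ * T) * ‖x T - x (T + 1)‖ ^ 2 := by positivity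
  rw [sum_sub_distrib, hzero]
  linarith [hpot T hT le_rfl, hxlast u hu]
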